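/- arXiv:2111.05320 — 3 statements merged into one kernel-verified Lean document; each statement's English description precedes it below -/
import Mathlib

section
/- Let n ≥ 1, 0 ≤ α₁ < 1/2, η ≥ 0, let A be a real n×n matrix and p ∈ ℝ, and let F ⊆ [n] satisfy |[n]∖F| ≤ α₁n and the spectral regularity condition with bound η for A. Then for every S ⊆ [n] with |S| ≥ n/2, |p_S − p| ≤ (‖(A − p_S)_{S×S}‖ + n·η) / ((1/2 − α₁)·n). -/
open scoped BigOperators

/-- The spectral norm of a real `m × n` matrix: the supremum of `|uᵀ M v|`
over unit vectors `u ∈ ℝ^m`, `v ∈ ℝ^n`. -/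
noncomputable def specNorm {m n : ℕ} (M : Matrix (Fin m) (Fin n) ℝ) : ℝ :=
  sSup { x : ℝ | ∃ u : Fin m → ℝ, ∃ v : Fin n → ℝ,
    (∑ i, u i ^ 2) = 1 ∧ (∑ j, v j ^ 2) = 1 ∧ x = |∑ i, ∑ j, u i * M i j * v j| }

/-- `M_{S×S'}`: the matrix agreeing with `M` on `S × S'` and zero elsewhere. -/
def restrict {m n : ℕ} (M : Matrix (Fin m) (Fin n) ℝ)
    (S : Finset (Fin m)) (S' : Finset (Fin n)) : Matrix (Fin m) (Fin n) ℝ :=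
  fun i j => if i ∈ S ∧ j ∈ S' then M i j else 0

/-- `p_S`: the empirical edge density `(Σ_{i,j∈S} A_{i,j}) / |S|²`. -/
noncomputable def pS {n : ℕ} (A : Matrix (Fin n) (Fin n) ℝ) (S : Finset (Fin n)) : ℝ :=
  (∑ i ∈ S, ∑ j ∈ S, A i j) / (S.card : ℝ) ^ 2

/-- `F` satisfies the spectral regularity condition with bound `η` for `A`:
for every `F' ⊆ F`, `‖(A − p)_{F'×F'}‖ ≤ n·η`. -/
def specReg {n : ℕ} (A : Matrix (Fin n) (Fin n) ℝ) (p η : ℝ) (F : Finset (Fin n)) : Prop :=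
  ∀ F' ⊆ F, specNorm (restrict (fun i j => A i j - p) F' F') ≤ (n : ℝ) * η

/-- The values `|uᵀ M v|` over unit vectors are bounded above by the sum of the absolute
values of the entries of `M`. -/
theorem bddAbove_abs_bilin_unit {m n : ℕ} (M : Matrix (Fin m) (Fin n) ℝ) :
    BddAbove { x : ℝ | ∃ u : Fin m → ℝ, ∃ v : Fin n → ℝ,
      (∑ i, u i ^ 2) = 1 ∧ (∑ j, v j ^ 2) = 1 ∧ x = |∑ i, ∑ j, u i * M i j * v j| } := by
  refine ⟨∑ i, ∑ j, |M i j|, ?_⟩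
  rintro x ⟨u, v, hu, hv, rfl⟩
  have hu1 : ∀ i, |u i| ≤ 1 := fun i => by
    rw [← sq_le_one_iff_abs_le_one, ← hu]
    exact Finset.single_le_sum (f := fun i => u i ^ 2) (fun _ _ => sq_nonneg _)
      (Finset.mem_univ i)
  have hv1 : ∀ j, |v j| ≤ 1 := fun j => by
    rw [← sq_le_one_iff_abs_le_one, ← hv]
    exact Finset.single_le_sum (f := fun j => v j ^ 2) (fun _ _ => sq_nonneg _)
      (Finset.mem_univ j)
  refine (Finset.abs_sum_le_sum_abs _ _).trans (Finset.sum_le_sum fun i _ => ?_)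
  refine (Finset.abs_sum_le_sum_abs _ _).trans (Finset.sum_le_sum fun j _ => ?_)
  rw [abs_mul, abs_mul]
  calc |u i| * |M i j| * |v j| ≤ 1 * |M i j| * 1 := by
        gcongr
        · exact hu1 i
        · exact hv1 j
    _ = |M i j| := by ring

/-- The sum of the entries of `M` over a square block `T × T` inside `S × S` is at most
`|T|` times the spectral norm of `M_{S×S}`. -/
theorem abs_sum_block_le_card_mul_specNorm {n : ℕ} (M : Matrix (Fin n) (Fin n) ℝ)
    {S T : Finset (Fin n)} (hTS : T ⊆ S) (hT : T.Nonempty) :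
    |∑ i ∈ T, ∑ j ∈ T, M i j| ≤ (T.card : ℝ) * specNorm (restrict M S S) := by
  have hk : (0 : ℝ) < T.card := by exact_mod_cast hT.card_pos
  have hsq : √(T.card : ℝ) ^ 2 = T.card := Real.sq_sqrt hk.le
  let u : Fin n → ℝ := fun i => if i ∈ T then (√(T.card : ℝ))⁻¹ else 0
  have hu : ∑ i, u i ^ 2 = 1 := by
    simp only [u, ite_pow, inv_pow, hsq, ne_eq, OfNat.ofNat_ne_zero, not_false_eq_true,
      zero_pow, Finset.sum_ite_mem, Finset.univ_inter, Finset.sum_const, nsmul_eq_mul]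
    exact mul_inv_cancel₀ hk.ne'
  have hval : ∑ i, ∑ j, u i * restrict M S S i j * u j =
      (T.card : ℝ)⁻¹ * ∑ i ∈ T, ∑ j ∈ T, M i j := by
    have hentry : ∀ i j, u i * restrict M S S i j * u j =
        if i ∈ T then (if j ∈ T then (T.card : ℝ)⁻¹ * M i j else 0) else 0 := by
      intro i j
      by_cases hi : i ∈ T
      · by_cases hj : j ∈ T
        · simp only [u, restrict, hi, hj, hTS hi, hTS hj, and_self, if_true]
          rw [show (T.card : ℝ)⁻¹ = (√(T.card : ℝ))⁻¹ ^ 2 by rw [inv_pow, hsq]]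
          ring
        · simp [u, hj]
      · simp [u, hi]
    simp only [hentry, Finset.mul_sum, Finset.sum_ite_irrel, Finset.sum_const_zero,
      Finset.sum_ite_mem, Finset.univ_inter]
  have hle : |(T.card : ℝ)⁻¹ * ∑ i ∈ T, ∑ j ∈ T, M i j| ≤ specNorm (restrict M S S) :=
    le_csSup (bddAbove_abs_bilin_unit _) ⟨u, u, hu, hu, by rw [hval]⟩
  rwa [abs_mul, abs_of_pos (inv_pos.mpr hk), inv_mul_le_iff₀ hk] at hle

/-- Theorem (coarse estimation): for every `S ⊆ [n]` with `|S| ≥ n/2`,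
`|p_S − p| ≤ (‖(A − p_S)_{S×S}‖ + n·η) / ((1/2 − α₁)·n)`. -/
theorem coarse_estimate {n : ℕ} (hn : 1 ≤ n) (α₁ η : ℝ)
    (hα₁0 : 0 ≤ α₁) (hα₁ : α₁ < 1 / 2) (hη : 0 ≤ η)
    (A : Matrix (Fin n) (Fin n) ℝ) (p : ℝ) (F : Finset (Fin n))
    (hFc : ((Finset.univ \ F).card : ℝ) ≤ α₁ * n)
    (hreg : specReg A p η F)
    (S : Finset (Fin n)) (hS : (n : ℝ) / 2 ≤ (S.card : ℝ)) :
    |pS A S - p| ≤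
      (specNorm (restrict (fun i j => A i j - pS A S) S S) + (n : ℝ) * η) /
        ((1 / 2 - α₁) * n) := by
  have hn0 : (0 : ℝ) < n := by exact_mod_cast hn
  have hpos : 0 < (1 / 2 - α₁) * n := mul_pos (by linarith) hn0
  have hcard : (S.card : ℝ) ≤ (S ∩ F).card + (Finset.univ \ F).card := by
    have h : S.card ≤ (S ∩ F).card + (Finset.univ \ F).card := by
      rw [← Finset.card_inter_add_card_sdiff S F]
      exact Nat.add_le_add_left
        (Finset.card_le_card (Finset.sdiff_subset_sdiff (Finset.subset_univ S) subset_rfl)) _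
    exact_mod_cast h
  set T := S ∩ F
  have hkT : (1 / 2 - α₁) * n ≤ T.card := by linarith
  have hk : (0 : ℝ) < T.card := hpos.trans_le hkT
  have hT : T.Nonempty := Finset.card_pos.mp (by exact_mod_cast hk)
  have h1 := abs_sum_block_le_card_mul_specNorm (fun i j => A i j - pS A S)
    (Finset.inter_subset_left : T ⊆ S) hT
  have h2 := (abs_sum_block_le_card_mul_specNorm (fun i j => A i j - p)
    (subset_refl T) hT).trans
    (mul_le_mul_of_nonneg_left (hreg T Finset.inter_subset_right) hk.le)
  have hdiff : (T.card : ℝ) * (T.card * (pS A S - p)) =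
      (∑ i ∈ T, ∑ j ∈ T, (A i j - p)) - ∑ i ∈ T, ∑ j ∈ T, (A i j - pS A S) := by
    simp only [Finset.sum_sub_distrib, Finset.sum_const, nsmul_eq_mul]
    ring
  have h3 := (abs_sub _ _).trans (add_le_add h2 h1)
  rw [← hdiff, abs_mul, abs_mul, abs_of_pos hk, ← mul_add, mul_le_mul_iff_right₀ hk] at h3
  rw [le_div_iff₀ hpos, mul_comm]
  exact (mul_le_mul_of_nonneg_right hkT (abs_nonneg _)).trans (h3.trans_eq (add_comm _ _))
end

section
/- Let n ≥ 1, 0 ≤ α₁ < 1/2, η ≥ 0, let A be a real n×n matrix and p ∈ ℝ, and let F ⊆ [n] satisfy |[n]∖F| ≤ α₁n and the spectral regularity condition with bound η for A. Suppose Ŝ ⊆ [n] with |Ŝ| ≥ n/2 minimizes ‖(A − p_S)_{S×S}‖ over all S ⊆ [n] with |S| ≥ n/2 (i.e., ‖(A − p_Ŝ)_{Ŝ×Ŝ}‖ ≤ ‖(A − p_S)_{S×S}‖ for all such S). Then ‖(A − p_Ŝ)_{Ŝ×Ŝ}‖ ≤ 2n·η and |p_Ŝ − p| ≤ 3η / (1/2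 − α₁). -/
open scoped BigOperators

lemma abs_bilin_le_specNorm {m n : ℕ} (M : Matrix (Fin m) (Fin n) ℝ) (u : Fin m → ℝ)
    (v : Fin n → ℝ) (hu : ∑ i, u i ^ 2 = 1) (hv : ∑ j, v j ^ 2 = 1) :
    |∑ i, ∑ j, u i * M i j * v j| ≤ specNorm M := by
  have coord_le : ∀ {k : ℕ} (w : Fin k → ℝ), ∑ i, w i ^ 2 = 1 → ∀ i, |w i| ≤ 1 := by
    intro k w hw i
    rw [← sq_le_one_iff_abs_le_one, ← hw]
    exact Finset.single_le_sum (f := fun i => w i ^ 2) (fun i _ => sq_nonneg _)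
      (Finset.mem_univ i)
  refine le_csSup ⟨∑ i, ∑ j, |M i j|, ?_⟩ ⟨u, v, hu, hv, rfl⟩
  rintro x ⟨u, v, hu, hv, rfl⟩
  refine (Finset.abs_sum_le_sum_abs _ _).trans (Finset.sum_le_sum fun i _ => ?_)
  refine (Finset.abs_sum_le_sum_abs _ _).trans (Finset.sum_le_sum fun j _ => ?_)
  rw [abs_mul, abs_mul]
  calc |u i| * |M i j| * |v j| ≤ 1 * |M i j| * 1 := by
        gcongr
        · exact coord_le u hu i
        · exact coord_le v hv j
    _ = |M i j| := by ring

lemma specNorm_nonneg {m n : ℕ} (M : Matrix (Fin m) (Fin n) ℝ) : 0 ≤ specNorm M := by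
  apply Real.sSup_nonneg
  rintro x ⟨u, v, -, -, rfl⟩
  exact abs_nonneg _

lemma abs_sum_le_card_mul_specNorm_restrict {n : ℕ} (M : Matrix (Fin n) (Fin n) ℝ)
    {I S : Finset (Fin n)} (hIS : I ⊆ S) :
    |∑ i ∈ I, ∑ j ∈ I, M i j| ≤ I.card * specNorm (restrict M S S) := by
  rcases I.eq_empty_or_nonempty with rfl | hI
  · simp
  have hc : (0 : ℝ) < I.card := by exact_mod_cast hI.card_pos
  set c : ℝ := (√(I.card : ℝ))⁻¹ with hcdef
  have hc2 : c * c = (I.card : ℝ)⁻¹ := by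
    rw [hcdef, ← mul_inv, Real.mul_self_sqrt hc.le]
  let u : Fin n → ℝ := fun i => if i ∈ I then c else 0
  have hu : ∑ i, u i ^ 2 = 1 := by
    simp only [u, ite_pow, ne_eq, OfNat.ofNat_ne_zero, not_false_eq_true, zero_pow,
      Finset.sum_ite_mem, Finset.univ_inter, Finset.sum_const, nsmul_eq_mul]
    rw [pow_two, hc2, mul_inv_cancel₀ hc.ne']
  have h := abs_bilin_le_specNorm (restrict M S S) u u hu hu
  have e : ∑ i, ∑ j, u i * restrict M S S i j * u j
      = (I.card : ℝ)⁻¹ * ∑ i ∈ I, ∑ j ∈ I, M i j := by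
    rw [← hc2, Finset.mul_sum, ← Finset.sum_subset (Finset.subset_univ I)]
    · refine Finset.sum_congr rfl fun i hi => ?_
      rw [Finset.mul_sum, ← Finset.sum_subset (Finset.subset_univ I)]
      · refine Finset.sum_congr rfl fun j hj => ?_
        simp only [u, restrict, hi, hj, hIS hi, hIS hj, and_self, if_true]
        ring
      · intro j _ hj
        simp [u, hj]
    · intro i _ hi
      simp [u, hi]
  rw [e, abs_mul, abs_of_pos (inv_pos.2 hc), inv_mul_le_iff₀ hc] at h
  exact h

lemma abs_sum_mul_sum_le_card {n : ℕ} (S : Finset (Fin n)) (u v : Fin n → ℝ)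
    (hu : ∑ i, u i ^ 2 = 1) (hv : ∑ j, v j ^ 2 = 1) :
    |(∑ i ∈ S, u i) * ∑ j ∈ S, v j| ≤ S.card := by
  have key : ∀ w : Fin n → ℝ, ∑ i, w i ^ 2 = 1 → (∑ i ∈ S, w i) ^ 2 ≤ S.card := by
    intro w hw
    have h1 := sq_sum_le_card_mul_sum_sq (s := S) (f := w)
    have h2 : ∑ i ∈ S, w i ^ 2 ≤ 1 := hw ▸
      Finset.sum_le_sum_of_subset_of_nonneg (Finset.subset_univ S) fun i _ _ => sq_nonneg _
    exact h1.trans (mul_le_of_le_one_right (Nat.cast_nonneg _) h2)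
  apply abs_le_of_sq_le_sq _ (Nat.cast_nonneg _)
  rw [mul_pow, pow_two (S.card : ℝ)]
  exact mul_le_mul (key u hu) (key v hv) (sq_nonneg _) (Nat.cast_nonneg _)

lemma specNorm_restrict_sub_const_le {n : ℕ} (A : Matrix (Fin n) (Fin n) ℝ) (p q : ℝ)
    (S : Finset (Fin n)) :
    specNorm (restrict (fun i j => A i j - q) S S) ≤
      specNorm (restrict (fun i j => A i j - p) S S) + |q - p| * S.card := by
  refine Real.sSup_le ?_ (add_nonneg (specNorm_nonneg _) (by positivity))
  rintro x ⟨u, v, hu, hv, rfl⟩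
  have e : ∑ i, ∑ j, u i * restrict (fun i j => A i j - q) S S i j * v j
      = ∑ i, ∑ j, u i * restrict (fun i j => A i j - p) S S i j * v j
        - (q - p) * ((∑ i ∈ S, u i) * ∑ j ∈ S, v j) := by
    have h : (∑ i ∈ S, u i) * ∑ j ∈ S, v j
        = ∑ i, ∑ j, if i ∈ S ∧ j ∈ S then u i * v j else 0 := by
      simp [Finset.sum_mul_sum, ite_and]
    rw [h, Finset.mul_sum, ← Finset.sum_sub_distrib]
    refine Finset.sum_congr rfl fun i _ => ?_
    rw [Finset.mul_sum, ← Finset.sum_sub_distrib]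
    refine Finset.sum_congr rfl fun j _ => ?_
    simp only [restrict]
    split_ifs <;> ring
  rw [e]
  refine (abs_sub _ _).trans (add_le_add (abs_bilin_le_specNorm _ u v hu hv) ?_)
  rw [abs_mul]
  exact mul_le_mul_of_nonneg_left (abs_sum_mul_sum_le_card S u v hu hv) (abs_nonneg _)

lemma sum_sub_const {n : ℕ} (A : Matrix (Fin n) (Fin n) ℝ) (p : ℝ) (I : Finset (Fin n)) :
    ∑ i ∈ I, ∑ j ∈ I, (A i j - p) = ∑ i ∈ I, ∑ j ∈ I, A i j - (I.card : ℝ) ^ 2 * p := by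
  simp only [Finset.sum_sub_distrib, Finset.sum_const, nsmul_eq_mul]
  ring

/-- Theorem (inefficient coarse estimator): if `Ŝ` with `|Ŝ| ≥ n/2` minimizes
`‖(A − p_S)_{S×S}‖` over all `S` with `|S| ≥ n/2`, then
`‖(A − p_Ŝ)_{Ŝ×Ŝ}‖ ≤ 2n·η` and `|p_Ŝ − p| ≤ 3η / (1/2 − α₁)`. -/
theorem inefficient_coarse_estimator {n : ℕ} (hn : 1 ≤ n) (α₁ η : ℝ)
    (hα₁0 : 0 ≤ α₁) (hα₁ : α₁ < 1 / 2) (hη : 0 ≤ η)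
    (A : Matrix (Fin n) (Fin n) ℝ) (p : ℝ) (F : Finset (Fin n))
    (hFc : ((Finset.univ \ F).card : ℝ) ≤ α₁ * n)
    (hreg : specReg A p η F)
    (Shat : Finset (Fin n)) (hShat : (n : ℝ) / 2 ≤ (Shat.card : ℝ))
    (hmin : ∀ S : Finset (Fin n), (n : ℝ) / 2 ≤ (S.card : ℝ) →
      specNorm (restrict (fun i j => A i j - pS A Shat) Shat Shat) ≤
        specNorm (restrict (fun i j => A i j - pS A S) S S)) :
    specNorm (restrict (fun i j => A i j - pS A Shat) Shat Shat) ≤ 2 * n * η ∧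
    |pS A Shat - p| ≤ 3 * η / (1 / 2 - α₁) := by
  have hn0 : (0 : ℝ) < n := by exact_mod_cast hn
  have hFcard : (1 - α₁) * n ≤ (F.card : ℝ) := by
    have h : (Finset.univ \ F).card + F.card = n := by
      simpa using Finset.card_sdiff_add_card_eq_card (Finset.subset_univ F)
    have h' : ((Finset.univ \ F).card : ℝ) + F.card = n := by exact_mod_cast h
    linarith
  have hFhalf : (n : ℝ) / 2 ≤ F.card := by nlinarith
  have hFpos : (0 : ℝ) < F.card := by linarith
  have hpF : |pS A F - p| * F.card ≤ n * η := by
    have h := (abs_sum_le_card_mul_specNorm_restrict (fun i j => A i j - p)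
      (Finset.Subset.refl F)).trans
      (mul_le_mul_of_nonneg_left (hreg F (Finset.Subset.refl F)) hFpos.le)
    have e : ∑ i ∈ F, ∑ j ∈ F, (A i j - p) = (F.card : ℝ) * ((pS A F - p) * F.card) := by
      rw [sum_sub_const, pS]
      field_simp
    rw [e, abs_mul, abs_of_pos hFpos, abs_mul, abs_of_pos hFpos] at h
    exact le_of_mul_le_mul_left h hFpos
  have hfirst : specNorm (restrict (fun i j => A i j - pS A Shat) Shat Shat) ≤ 2 * n * η := by
    have h1 := specNorm_restrict_sub_const_le A p (pS A F) F
    linarith [hmin F hFhalf, hreg F (Finset.Subset.refl F)]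
  refine ⟨hfirst, ?_⟩
  set I := Shat ∩ F with hI
  have hIcard : (1 / 2 - α₁) * n ≤ (I.card : ℝ) := by
    have h : Shat.card ≤ I.card + (Finset.univ \ F).card := by
      rw [← Finset.card_inter_add_card_sdiff Shat F]
      exact Nat.add_le_add_left (Finset.card_le_card
        (Finset.sdiff_subset_sdiff (Finset.subset_univ _) (Finset.Subset.refl F))) _
    have h' : (Shat.card : ℝ) ≤ I.card + (Finset.univ \ F).card := by exact_mod_cast h
    linarith
  have hα : 0 < 1 / 2 - α₁ := by linarith
  have hIpos : (0 : ℝ) < I.card := (mul_pos hα hn0).trans_le hIcard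
  have h1 := (abs_sum_le_card_mul_specNorm_restrict (fun i j => A i j - p)
    (Finset.inter_subset_right : I ⊆ F)).trans
    (mul_le_mul_of_nonneg_left (hreg F (Finset.Subset.refl F)) hIpos.le)
  have h2 := (abs_sum_le_card_mul_specNorm_restrict (fun i j => A i j - pS A Shat)
    (Finset.inter_subset_left : I ⊆ Shat)).trans
    (mul_le_mul_of_nonneg_left hfirst hIpos.le)
  have h3 := (abs_sub _ _).trans (add_le_add h1 h2)
  have e : ∑ i ∈ I, ∑ j ∈ I, (A i j - p) - ∑ i ∈ I, ∑ j ∈ I, (A i j - pS A Shat)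
      = (I.card : ℝ) * ((pS A Shat - p) * I.card) := by
    rw [sum_sub_const, sum_sub_const]
    ring
  rw [e, abs_mul, abs_of_pos hIpos, abs_mul, abs_of_pos hIpos, ← mul_add] at h3
  have h4 := le_of_mul_le_mul_left h3 hIpos
  have h5 := (mul_le_mul_of_nonneg_left hIcard (abs_nonneg (pS A Shat - p))).trans h4
  rw [le_div_iff₀ hα]
  exact le_of_mul_le_mul_right (by linarith) hn0
end

section
/- Let n ≥ 5, γ ∈ (0, 1/2], and p ∈ (0, 1/2] with p ≥ 0.01/n and p + 0.1·max(γ√(p/n), γ/n) ≤ 1. Then the total variation distance between the binomial distributions Bin(n−1, p) and Bin(n−1, p + 0.1·max(γ√(p/n), γ/n)) is at most 0.15γ. -/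
open scoped BigOperators

/-- The binomial probability mass function: `Bin(m, q)` assigns probability
`C(m,k)·q^k·(1−q)^{m−k}` to `k`. -/
noncomputable def binomPMF (m : ℕ) (q : ℝ) (k : ℕ) : ℝ :=
  (m.choose k : ℝ) * q ^ k * (1 - q) ^ (m - k)

/-- The total variation distance between `Bin(m, q)` and `Bin(m, q')`:
`(1/2)·Σ_x |P(x) − Q(x)|`. -/
noncomputable def tvBinom (m : ℕ) (q q' : ℝ) : ℝ :=
  (1 / 2) * ∑ k ∈ Finset.range (m + 1), |binomPMF m q k - binomPMF m q' k|

lemma binomPMF_nonneg {q : ℝ} (h0 : 0 ≤ q) (h1 : q ≤ 1) (m k : ℕ) : 0 ≤ binomPMF m q k := by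
  have : 0 ≤ 1 - q := by linarith
  unfold binomPMF
  positivity

lemma sum_binomPMF (m : ℕ) (q : ℝ) : ∑ k ∈ Finset.range (m + 1), binomPMF m q k = 1 := by
  have h := add_pow q (1 - q) m
  rw [add_sub_cancel, one_pow] at h
  rw [h]
  refine Finset.sum_congr rfl fun k _ => ?_
  unfold binomPMF
  ring

lemma binomPMF_succ_self (m : ℕ) (q : ℝ) : binomPMF m q (m + 1) = 0 := by
  simp [binomPMF]

lemma binomPMF_succ_zero (m : ℕ) (q : ℝ) :
    binomPMF (m + 1) q 0 = (1 - q) * binomPMF m q 0 := by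
  simp [binomPMF, pow_succ']

lemma binomPMF_succ_succ {m k : ℕ} (hk : k ≤ m) (q : ℝ) :
    binomPMF (m + 1) q (k + 1) = q * binomPMF m q k + (1 - q) * binomPMF m q (k + 1) := by
  unfold binomPMF
  rw [Nat.choose_succ_succ, Nat.add_sub_add_right]
  rcases hk.eq_or_lt with rfl | hlt
  · simp [pow_succ']
  · obtain ⟨d, rfl⟩ := Nat.exists_eq_add_of_lt hlt
    rw [show k + d + 1 - k = d + 1 by omega, show k + d + 1 - (k + 1) = d by omega]
    push_cast
    ring

/-- Adding one trial increases the `ℓ¹` distance between two binomial laws by at most twice the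
difference of their success probabilities. -/
lemma sum_abs_binomPMF_sub_succ_le {p q : ℝ} (hp : 0 ≤ p) (hpq : p ≤ q) (hq : q ≤ 1) (m : ℕ) :
    ∑ k ∈ Finset.range (m + 2), |binomPMF (m + 1) p k - binomPMF (m + 1) q k| ≤
      ∑ k ∈ Finset.range (m + 1), |binomPMF m p k - binomPMF m q k| + 2 * (q - p) := by
  set P := binomPMF m p
  set Q := binomPMF m q
  have hP : ∀ k, 0 ≤ P k := binomPMF_nonneg hp (hpq.trans hq) m
  have hzero : |binomPMF (m + 1) p 0 - binomPMF (m + 1) q 0| ≤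
      (1 - q) * |P 0 - Q 0| + (q - p) * P 0 := by
    rw [binomPMF_succ_zero, binomPMF_succ_zero]
    calc |(1 - p) * P 0 - (1 - q) * Q 0|
        = |(1 - q) * (P 0 - Q 0) + (q - p) * P 0| := by congr 1; ring
      _ ≤ |(1 - q) * (P 0 - Q 0)| + |(q - p) * P 0| := abs_add_le _ _
      _ = _ := by
        rw [abs_mul, abs_mul, abs_of_nonneg (sub_nonneg.2 hq), abs_of_nonneg (sub_nonneg.2 hpq),
          abs_of_nonneg (hP 0)]
  have hsucc : ∀ k ∈ Finset.range (m + 1),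
      |binomPMF (m + 1) p (k + 1) - binomPMF (m + 1) q (k + 1)| ≤
        (q * |P k - Q k| + (q - p) * P k) +
          ((1 - q) * |P (k + 1) - Q (k + 1)| + (q - p) * P (k + 1)) := by
    intro k hk
    have hkm : k ≤ m := Nat.lt_succ_iff.1 (Finset.mem_range.1 hk)
    rw [binomPMF_succ_succ hkm, binomPMF_succ_succ hkm]
    change |p * P k + (1 - p) * P (k + 1) - (q * Q k + (1 - q) * Q (k + 1))| ≤ _
    have h1 := mul_le_mul_of_nonneg_left (le_abs_self (P k - Q k)) (hp.trans hpq)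
    have h2 := mul_le_mul_of_nonneg_left (neg_abs_le (P k - Q k)) (hp.trans hpq)
    have h3 := mul_le_mul_of_nonneg_left (le_abs_self (P (k + 1) - Q (k + 1))) (sub_nonneg.2 hq)
    have h4 := mul_le_mul_of_nonneg_left (neg_abs_le (P (k + 1) - Q (k + 1))) (sub_nonneg.2 hq)
    have h5 := mul_nonneg (sub_nonneg.2 hpq) (hP k)
    have h6 := mul_nonneg (sub_nonneg.2 hpq) (hP (k + 1))
    rw [abs_le]
    constructor <;> linarith
  have hshift : ∀ f : ℕ → ℝ, f (m + 1) = 0 →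
      ∑ k ∈ Finset.range (m + 1), f (k + 1) + f 0 = ∑ k ∈ Finset.range (m + 1), f k := by
    intro f hf
    rw [← Finset.sum_range_succ', Finset.sum_range_succ, hf, add_zero]
  have hPtop : P (m + 1) = 0 := binomPMF_succ_self m p
  have hQtop : Q (m + 1) = 0 := binomPMF_succ_self m q
  have hPsum : ∑ k ∈ Finset.range (m + 1), P k = 1 := sum_binomPMF m p
  have hDshift := hshift (fun k => |P k - Q k|) (by simp [hPtop, hQtop])
  have hPshift := hshift P hPtop
  rw [Finset.sum_range_succ']
  have h := Finset.sum_le_sum hsucc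
  simp only [Finset.sum_add_distrib, ← Finset.mul_sum] at h
  rw [← eq_sub_iff_add_eq] at hDshift hPshift
  rw [hDshift, hPshift, hPsum] at h
  linarith

/-- The coupling bound: `Bin(m, p)` and `Bin(m, q)` are at distance at most `m (q - p)`. -/
lemma tvBinom_le_mul_sub {p q : ℝ} (hp : 0 ≤ p) (hpq : p ≤ q) (hq : q ≤ 1) (m : ℕ) :
    tvBinom m p q ≤ m * (q - p) := by
  induction m with
  | zero => simp [tvBinom, binomPMF]
  | succ m ih =>
    have h := sum_abs_binomPMF_sub_succ_le hp hpq hq m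
    unfold tvBinom at ih ⊢
    push_cast
    linarith

/-- The second moment of the likelihood ratio of two binomial laws. -/
lemma sum_sq_binomPMF_div {p : ℝ} (hp0 : 0 < p) (hp1 : p < 1) (q : ℝ) (m : ℕ) :
    ∑ k ∈ Finset.range (m + 1), binomPMF m q k ^ 2 / binomPMF m p k =
      (1 + (q - p) ^ 2 / (p * (1 - p))) ^ m := by
  have hp1' : 0 < 1 - p := by linarith
  have hbase : 1 + (q - p) ^ 2 / (p * (1 - p)) = q ^ 2 / p + (1 - q) ^ 2 / (1 - p) := by
    field_simp
    ring
  rw [hbase, add_pow]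
  refine Finset.sum_congr rfl fun k hk => ?_
  have hc : (0 : ℝ) < m.choose k :=
    Nat.cast_pos.2 (Nat.choose_pos (Nat.lt_succ_iff.1 (Finset.mem_range.1 hk)))
  unfold binomPMF
  rw [div_pow, div_pow, ← pow_mul, ← pow_mul]
  field_simp
  ring

/-- The total variation distance between binomial laws is controlled by their `χ²`-divergence. -/
lemma sq_two_mul_tvBinom_le {p : ℝ} (hp0 : 0 < p) (hp1 : p < 1) (q : ℝ) (m : ℕ) :
    (2 * tvBinom m p q) ^ 2 ≤ (1 + (q - p) ^ 2 / (p * (1 - p))) ^ m - 1 := by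
  have hpos : ∀ k ∈ Finset.range (m + 1), 0 < binomPMF m p k := by
    intro k hk
    have hc := Nat.choose_pos (Nat.lt_succ_iff.1 (Finset.mem_range.1 hk))
    have : 0 < 1 - p := by linarith
    unfold binomPMF
    positivity
  have hCS := Finset.sum_sq_le_sum_mul_sum_of_sq_le_mul (Finset.range (m + 1))
    (r := fun k => |binomPMF m p k - binomPMF m q k|) (f := binomPMF m p)
    (g := fun k => (binomPMF m p k - binomPMF m q k) ^ 2 / binomPMF m p k)
    (fun k hk => (hpos k hk).le) (fun k hk => div_nonneg (sq_nonneg _) (hpos k hk).le)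
    (fun k hk => by rw [sq_abs, mul_div_cancel₀ _ (hpos k hk).ne'])
  have hexpand : ∑ k ∈ Finset.range (m + 1),
      (binomPMF m p k - binomPMF m q k) ^ 2 / binomPMF m p k =
        ∑ k ∈ Finset.range (m + 1),
          (binomPMF m q k ^ 2 / binomPMF m p k - 2 * binomPMF m q k + binomPMF m p k) := by
    refine Finset.sum_congr rfl fun k hk => ?_
    have := (hpos k hk).ne'
    field_simp
    ring
  rw [hexpand, Finset.sum_add_distrib, Finset.sum_sub_distrib, ← Finset.mul_sum, sum_binomPMF,
    sum_binomPMF, sum_sq_binomPMF_div hp0 hp1] at hCS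
  unfold tvBinom
  linarith

/-- For `n ≥ 5`, `γ ∈ (0, 1/2]`, and `p ∈ (0, 1/2]` with `p ≥ 0.01/n` and
`p + 0.1·max(γ√(p/n), γ/n) ≤ 1`, the total variation distance between
`Bin(n−1, p)` and `Bin(n−1, p + 0.1·max(γ√(p/n), γ/n))` is at most `0.15γ`. -/
theorem binomial_tv_bound (n : ℕ) (hn : 5 ≤ n) (γ p : ℝ)
    (hγ0 : 0 < γ) (hγ : γ ≤ 1 / 2)
    (hp0 : 0 < p) (hp : p ≤ 1 / 2) (hplo : 0.01 / (n : ℝ) ≤ p)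
    (hsum : p + 0.1 * max (γ * Real.sqrt (p / n)) (γ / n) ≤ 1) :
    tvBinom (n - 1) p (p + 0.1 * max (γ * Real.sqrt (p / n)) (γ / n)) ≤
      0.15 * γ := by
  have hn0 : (0 : ℝ) < n := by positivity
  have hm : ((n - 1 : ℕ) : ℝ) ≤ n := by exact_mod_cast Nat.sub_le n 1
  rcases le_total (γ * Real.sqrt (p / n)) (γ / n) with h | h
  · rw [max_eq_right h] at hsum ⊢
    have hgn : 0 < γ / n := by positivity
    refine (tvBinom_le_mul_sub hp0.le (by linarith) hsum (n - 1)).trans ?_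
    calc ((n - 1 : ℕ) : ℝ) * (p + 0.1 * (γ / n) - p) ≤ n * (p + 0.1 * (γ / n) - p) :=
          mul_le_mul_of_nonneg_right hm (by linarith)
      _ = 0.1 * γ := by field_simp; ring
      _ ≤ 0.15 * γ := by linarith
  · rw [max_eq_left h]
    have hchi := sq_two_mul_tvBinom_le hp0 (by linarith) (p + 0.1 * (γ * Real.sqrt (p / n))) (n - 1)
    set a := (p + 0.1 * (γ * Real.sqrt (p / n)) - p) ^ 2 / (p * (1 - p)) with ha_def
    have hq : 0 < 1 - p := by linarith
    have ha0 : 0 ≤ a := by positivity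
    have ha : n * a ≤ 0.02 * γ ^ 2 := by
      have hsq : (p + 0.1 * (γ * Real.sqrt (p / n)) - p) ^ 2 = 0.01 * γ ^ 2 * (p / n) := by
        rw [add_sub_cancel_left, mul_pow, mul_pow, Real.sq_sqrt (by positivity)]
        ring
      have hna : n * a = 0.01 * γ ^ 2 / (1 - p) := by
        rw [ha_def, hsq]
        field_simp
      rw [hna, div_le_iff₀ hq]
      nlinarith [sq_nonneg γ]
    have hγ2 : γ ^ 2 ≤ 1 / 4 := by nlinarith
    have hexp : (1 + a) ^ (n - 1) ≤ 1 + 0.09 * γ ^ 2 := by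
      calc (1 + a) ^ (n - 1) ≤ Real.exp a ^ (n - 1) :=
            pow_le_pow_left₀ (by linarith) (by linarith [Real.add_one_le_exp a]) _
        _ = Real.exp ((n - 1 : ℕ) * a) := (Real.exp_nat_mul a (n - 1)).symm
        _ ≤ Real.exp (0.02 * γ ^ 2) :=
            Real.exp_le_exp.2 ((mul_le_mul_of_nonneg_right hm ha0).trans ha)
        _ ≤ 1 + 0.09 * γ ^ 2 := by
            have hb := Real.abs_exp_sub_one_sub_id_le (x := 0.02 * γ ^ 2)
              (by rw [abs_of_nonneg (by positivity)]; linarith)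
            have := (abs_le.1 hb).2
            nlinarith [sq_nonneg γ]
    have hfin : 2 * tvBinom (n - 1) p (p + 0.1 * (γ * Real.sqrt (p / n))) ≤ 0.3 * γ :=
      abs_le_of_sq_le_sq' (by linarith) (by positivity) |>.2
    linarith
end
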